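/- Let k be a field of characteristic 2, X a type of generators, A the free unital associative k-algebra on X, ∂ a differential on A, and ε an augmentation of (A, ∂). Let Ψ_ε : A → A be the algebra automorphism determined on generators by Ψ_ε(x) = x − ε(x)·1 (its inverse is determined by x ↦ x + ε(x)·1), and set ∂^ε := Ψ_ε∘∂∘Ψ_ε^{-1}. Then: (i) ∂^ε has no constant term, i.e. π₀∘∂^ε = 0; and (ii) the linearized differential (∂^ε)₁ : A₁ → A₁, defined as π₁∘∂^ε restricted to the span A₁ of the generators, satisfies (∂^ε)₁∘(∂^ε)₁ = 0. -/

import Mathlib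

open scoped Classical

/-- The projection of the free algebra onto its word-length-`m` part `A_m`, defined via
the basis of the free algebra indexed by the free monoid (words) on the generators. -/
noncomputable def wordProj (k X : Type*) [Field k] (m : ℕ) :
    FreeAlgebra k X →ₗ[k] FreeAlgebra k X :=
  (FreeAlgebra.basisFreeMonoid k X).constr k fun w =>
    if FreeMonoid.length w = m then FreeAlgebra.basisFreeMonoid k X w else 0

/-- The span `A₁` of the generators of the free algebra. -/
def genSpan (k X : Type*) [Field k] : Submodule k (FreeAlgebra k X) :=
  Submodule.span k (Set.range (FreeAlgebra.ι k : X → FreeAlgebra k X))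

/-- A differential on the free algebra: square zero and the (sign-free, characteristic
two) Leibniz rule. -/
def IsDifferential {k X : Type*} [Field k]
    (d : FreeAlgebra k X →ₗ[k] FreeAlgebra k X) : Prop :=
  (∀ a, d (d a) = 0) ∧ ∀ u v : FreeAlgebra k X, d (u * v) = d u * v + u * d v

/-- An augmentation of a DGA `(A, ∂)`: a unital algebra map to `k` vanishing on `im ∂`. -/
def IsAugmentation {k X : Type*} [Field k]
    (d : FreeAlgebra k X →ₗ[k] FreeAlgebra k X) (ε : FreeAlgebra k X →ₐ[k] k) : Prop :=
  ∀ a, ε (d a) = 0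

/-- The algebra endomorphism `Ψ_ε` determined on generators by `x ↦ x − ε(x)·1`. -/
noncomputable def PsiAug {k X : Type*} [Field k] (ε : FreeAlgebra k X →ₐ[k] k) :
    FreeAlgebra k X →ₐ[k] FreeAlgebra k X :=
  FreeAlgebra.lift k fun x =>
    FreeAlgebra.ι k x - algebraMap k (FreeAlgebra k X) (ε (FreeAlgebra.ι k x))

/-- The inverse `Ψ_ε⁻¹`, determined on generators by `x ↦ x + ε(x)·1`. -/
noncomputable def PsiAugInv {k X : Type*} [Field k] (ε : FreeAlgebra k X →ₐ[k] k) :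
    FreeAlgebra k X →ₐ[k] FreeAlgebra k X :=
  FreeAlgebra.lift k fun x =>
    FreeAlgebra.ι k x + algebraMap k (FreeAlgebra k X) (ε (FreeAlgebra.ι k x))

/-- The conjugated differential `∂^ε = Ψ_ε ∘ ∂ ∘ Ψ_ε⁻¹`. -/
noncomputable def conjDiff {k X : Type*} [Field k]
    (d : FreeAlgebra k X →ₗ[k] FreeAlgebra k X) (ε : FreeAlgebra k X →ₐ[k] k) :
    FreeAlgebra k X →ₗ[k] FreeAlgebra k X :=
  (PsiAug ε).toLinearMap ∘ₗ d ∘ₗ (PsiAugInv ε).toLinearMap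

namespace FreeAlgebra

variable {k X : Type*} [Field k]

theorem basisFreeMonoid_apply (w : FreeMonoid X) :
    basisFreeMonoid k X w = FreeMonoid.lift (ι k) w := by
  have h : basisFreeMonoid k X w
      = equivMonoidAlgebraFreeMonoid.symm (MonoidAlgebra.of k (FreeMonoid X) w) := rfl
  rw [h]
  simp [equivMonoidAlgebraFreeMonoid]

theorem basisFreeMonoid_one : basisFreeMonoid k X 1 = 1 := by
  simp [basisFreeMonoid_apply]

theorem basisFreeMonoid_mul (v w : FreeMonoid X) :
    basisFreeMonoid k X (v * w) = basisFreeMonoid k X v * basisFreeMonoid k X w := by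
  simp [basisFreeMonoid_apply]

theorem basisFreeMonoid_of (x : X) : basisFreeMonoid k X (FreeMonoid.of x) = ι k x := by
  simp [basisFreeMonoid_apply]

theorem algebraMapInv_basisFreeMonoid (w : FreeMonoid X) :
    algebraMapInv (basisFreeMonoid k X w) = if w.length = 0 then (1 : k) else 0 := by
  induction w using FreeMonoid.inductionOn' with
  | one => simp [basisFreeMonoid_one]
  | of_mul x w _ => simp [basisFreeMonoid_mul, basisFreeMonoid_of, algebraMapInv]

theorem wordProj_basisFreeMonoid (m : ℕ) (w : FreeMonoid X) :
    wordProj k X m (basisFreeMonoid k X w) =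
      if w.length = m then basisFreeMonoid k X w else 0 := by
  simp [wordProj, Module.Basis.constr_basis]

theorem wordProj_zero_apply (a : FreeAlgebra k X) :
    wordProj k X 0 a = algebraMap k (FreeAlgebra k X) (algebraMapInv a) := by
  suffices h : wordProj k X 0 =
      Algebra.linearMap k (FreeAlgebra k X) ∘ₗ algebraMapInv.toLinearMap from
    LinearMap.congr_fun h a
  refine (basisFreeMonoid k X).ext fun w => ?_
  simp only [LinearMap.comp_apply, AlgHom.toLinearMap_apply, Algebra.linearMap_apply,
    wordProj_basisFreeMonoid, algebraMapInv_basisFreeMonoid]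
  split_ifs with h
  · rw [FreeMonoid.length_eq_zero.1 h, basisFreeMonoid_one, map_one]
  · rw [map_zero]

/-- The projection onto words of length one is a derivation with respect to the
constant term. -/
theorem wordProj_one_mul (a b : FreeAlgebra k X) :
    wordProj k X 1 (a * b) =
      algebraMapInv a • wordProj k X 1 b + algebraMapInv b • wordProj k X 1 a := by
  let f : FreeAlgebra k X →ₗ[k] k := algebraMapInv.toLinearMap
  let B := (LinearMap.lsmul k (FreeAlgebra k X)).compl₁₂ f (wordProj k X 1)
  suffices h : (LinearMap.mul k (FreeAlgebra k X)).compr₂ (wordProj k X 1) = B + B.flip from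
    LinearMap.congr_fun₂ h a b
  refine LinearMap.ext_basis (basisFreeMonoid k X) (basisFreeMonoid k X) fun v w => ?_
  change wordProj k X 1 (basisFreeMonoid k X v * basisFreeMonoid k X w) =
    algebraMapInv (basisFreeMonoid k X v) • wordProj k X 1 (basisFreeMonoid k X w) +
      algebraMapInv (basisFreeMonoid k X w) • wordProj k X 1 (basisFreeMonoid k X v)
  rw [← basisFreeMonoid_mul]
  simp only [wordProj_basisFreeMonoid, algebraMapInv_basisFreeMonoid, FreeMonoid.length_mul]
  by_cases hv : v.length = 0
  · obtain rfl := FreeMonoid.length_eq_zero.1 hv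
    simp
  · by_cases hw : w.length = 0
    · obtain rfl := FreeMonoid.length_eq_zero.1 hw
      simp
    · have : v.length + w.length ≠ 1 := by omega
      simp [hv, hw, this]

end FreeAlgebra

section

open FreeAlgebra

variable {k X : Type*} [Field k]

theorem PsiAugInv_PsiAug (ε : FreeAlgebra k X →ₐ[k] k) (a : FreeAlgebra k X) :
    PsiAugInv ε (PsiAug ε a) = a := by
  suffices h : (PsiAugInv ε).comp (PsiAug ε) = AlgHom.id k _ from DFunLike.congr_fun h a
  ext x
  simp [PsiAug, PsiAugInv]

theorem PsiAug_PsiAugInv (ε : FreeAlgebra k X →ₐ[k] k) (a : FreeAlgebra k X) :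
    PsiAug ε (PsiAugInv ε a) = a := by
  suffices h : (PsiAug ε).comp (PsiAugInv ε) = AlgHom.id k _ from DFunLike.congr_fun h a
  ext x
  simp [PsiAug, PsiAugInv]

theorem algebraMapInv_PsiAug [CharP k 2] (ε : FreeAlgebra k X →ₐ[k] k) (a : FreeAlgebra k X) :
    algebraMapInv (PsiAug ε a) = ε a := by
  suffices h : algebraMapInv.comp (PsiAug ε) = ε from DFunLike.congr_fun h a
  ext x
  simp [PsiAug, algebraMapInv, CharTwo.neg_eq]

theorem IsDifferential.conjDiff {d : FreeAlgebra k X →ₗ[k] FreeAlgebra k X}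
    (hd : IsDifferential d) (ε : FreeAlgebra k X →ₐ[k] k) : IsDifferential (conjDiff d ε) := by
  refine ⟨fun a => ?_, fun u v => ?_⟩
  · simp [_root_.conjDiff, PsiAugInv_PsiAug, hd.1]
  · simp [_root_.conjDiff, hd.2, PsiAug_PsiAugInv]

theorem IsDifferential.map_one {d : FreeAlgebra k X →ₗ[k] FreeAlgebra k X}
    (hd : IsDifferential d) : d 1 = 0 := by
  simpa using hd.2 1 1

/-- The linear part of a differential without constant term only depends on the linear
part of its argument. -/
theorem IsDifferential.wordProj_one_apply_wordProj_one
    {d : FreeAlgebra k X →ₗ[k] FreeAlgebra k X} (hd : IsDifferential d)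
    (h₀ : ∀ a, algebraMapInv (d a) = 0) (a : FreeAlgebra k X) :
    wordProj k X 1 (d (wordProj k X 1 a)) = wordProj k X 1 (d a) := by
  suffices h : wordProj k X 1 ∘ₗ d ∘ₗ wordProj k X 1 = wordProj k X 1 ∘ₗ d from
    LinearMap.congr_fun h a
  refine (basisFreeMonoid k X).ext fun w => ?_
  simp only [LinearMap.comp_apply, wordProj_basisFreeMonoid]
  split_ifs with h
  · rfl
  induction w using FreeMonoid.casesOn with
  | one => simp [basisFreeMonoid_one, hd.map_one]
  | of_mul x w =>
    have hw : w.length ≠ 0 := by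
      intro hw
      simp [hw] at h
    simp [basisFreeMonoid_mul, hd.2, wordProj_one_mul, h₀, algebraMapInv_basisFreeMonoid, hw]

end

/-- over a field of characteristic 2, for a differential `∂` on the free
algebra with an augmentation `ε`, the conjugated differential `∂^ε = Ψ_ε∘∂∘Ψ_ε⁻¹` has
(i) no constant term (`π₀ ∘ ∂^ε = 0`), and (ii) its linearization `(∂^ε)₁ = π₁ ∘ ∂^ε`
restricted to the span `A₁` of the generators squares to zero. -/
theorem conjugated_differential_linearizes {k X : Type*} [Field k] [CharP k 2]
    (d : FreeAlgebra k X →ₗ[k] FreeAlgebra k X) (hd : IsDifferential d)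
    (ε : FreeAlgebra k X →ₐ[k] k) (hε : IsAugmentation d ε) :
    (∀ a : FreeAlgebra k X, wordProj k X 0 (conjDiff d ε a) = 0) ∧
    ∀ a ∈ genSpan k X,
      wordProj k X 1 (conjDiff d ε (wordProj k X 1 (conjDiff d ε a))) = 0 := by
  have h₀ (a : FreeAlgebra k X) : FreeAlgebra.algebraMapInv (conjDiff d ε a) = 0 :=
    (algebraMapInv_PsiAug ε _).trans (hε _)
  refine ⟨fun a => ?_, fun a _ => ?_⟩
  · rw [FreeAlgebra.wordProj_zero_apply, h₀, map_zero]
  · rw [(hd.conjDiff ε).wordProj_one_apply_wordProj_one h₀, (hd.conjDiff ε).1, map_zero]
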